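/- arXiv:2009.10980 — 7 statements merged into one kernel-verified Lean document; each statement's English description precedes it below -/
import Mathlib

section
/- Let K be a category equipped with a factorization system (E,M) and let λ be a regular cardinal. Then the colimit of any λ-small diagram (a diagram whose category of indices has fewer than λ morphisms) of objects that are λ-generated w.r.t. M is again λ-generated w.r.t. M, provided the colimit exists in K. -/
open CategoryTheory CategoryTheory.Limits Opposite

universe w v u u₂

namespace LocallyGen

variable {K : Type u} [Category.{v} K]

/-- `m` has the unique right lifting property w.r.t. `e`
(every commutative square has a unique diagonal filler). -/
def UniqueLift {A B X Y : K} (e : A ⟶ B) (m : X ⟶ Y) : Prop :=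
  ∀ (u : A ⟶ X) (v : B ⟶ Y), u ≫ m = e ≫ v →
    ∃! d : B ⟶ X, e ≫ d = u ∧ d ≫ m = v

/-- An (orthogonal) factorization system `(E, M)` on `K`: both classes contain all
isomorphisms and are closed under composition, every morphism factors as an `E`-morphism
followed by an `M`-morphism, and `E` is orthogonal to `M`. -/
structure FactorizationSystem (K : Type u) [Category.{v} K] where
  E : MorphismProperty K
  M : MorphismProperty K
  E_iso : ∀ {A B : K} (f : A ⟶ B), IsIso f → E f
  M_iso : ∀ {A B : K} (f : A ⟶ B), IsIso f → M f
  E_comp : ∀ {A B C : K} (f : A ⟶ B) (g : B ⟶ C), E f → E g → E (f ≫ g)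
  M_comp : ∀ {A B C : K} (f : A ⟶ B) (g : B ⟶ C), M f → M g → M (f ≫ g)
  factor : ∀ {A B : K} (f : A ⟶ B), ∃ (C : K) (e : A ⟶ C) (m : C ⟶ B), E e ∧ M m ∧ e ≫ m = f
  orth : ∀ {A B X Y : K} (e : A ⟶ B) (m : X ⟶ Y), E e → M m → UniqueLift e m

/-- A preorder is `κ`-directed if every subset of cardinality `< κ` has an upper bound. -/
def CardinalDirected (I : Type w) [Preorder I] (κ : Cardinal.{w}) : Prop :=
  ∀ S : Set I, Cardinal.mk S < κ → ∃ i : I, ∀ j ∈ S, j ≤ i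

/-- All connecting morphisms of a diagram indexed by a preorder lie in `M`. -/
def DiagramInM (M : MorphismProperty K) {I : Type w} [Preorder I] (D : I ⥤ K) : Prop :=
  ∀ ⦃i j : I⦄ (h : i ≤ j), M (D.map (homOfLE h))

/-- `A` is `κ`-generated w.r.t. `M`: the hom-functor `K(A, -) : K ⥤ Type` preserves
`κ`-directed colimits of `M`-morphisms. -/
def IsGenerated (M : MorphismProperty K) (κ : Cardinal.{v}) (A : K) : Prop :=
  ∀ (I : Type v) [Preorder I], CardinalDirected I κ →
    ∀ (D : I ⥤ K), DiagramInM M D →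
      ∀ (c : Cocone D), IsColimit c →
        Nonempty (IsColimit ((coyoneda.obj (op A)).mapCocone c))

/-- A small category is `κ`-small if it has fewer than `κ` morphisms. -/
def IsCardinalSmall (J : Type w) [SmallCategory J] (κ : Cardinal.{w}) : Prop :=
  Cardinal.mk (Σ (a : J) (b : J), a ⟶ b) < κ

/-- Two `E`-quotients of `A` are isomorphic as quotients. -/
def QuotientRel (E : MorphismProperty K) (A : K)
    (p q : Σ B : K, {e : A ⟶ B // E e}) : Prop :=
  ∃ i : p.1 ≅ q.1, p.2.1 ≫ i.hom = q.2.1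

/-- The factorization system `(E, M)` is `κ`-convenient: `K` is `E`-cowellpowered and
`M` is closed under `κ`-directed colimits. -/
structure Convenient (F : FactorizationSystem K) (κ : Cardinal.{v}) : Prop where
  cowellpowered : ∀ A : K, Small.{v} (Quot (QuotientRel F.E A))
  M_cocone : ∀ (I : Type v) [Preorder I], CardinalDirected I κ →
      ∀ (D : I ⥤ K), DiagramInM F.M D → ∀ (c : Cocone D), IsColimit c →
        ∀ i : I, F.M (c.ι.app i)
  M_desc : ∀ (I : Type v) [Preorder I], CardinalDirected I κ →
      ∀ (D : I ⥤ K), DiagramInM F.M D → ∀ (c : Cocone D) (hc : IsColimit c)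
        (c' : Cocone D), (∀ i : I, F.M (c'.ι.app i)) → F.M (hc.desc c')

/-- A presentation of `X` as a `κ`-directed colimit of objects from `S`
and morphisms from `M`. -/
structure DirectedColimitPresentation (M : MorphismProperty K) (κ : Cardinal.{v})
    (S : Set K) (X : K) where
  I : Type v
  [instI : Preorder I]
  directed : CardinalDirected I κ
  D : I ⥤ K
  mem : ∀ i : I, D.obj i ∈ S
  inM : DiagramInM M D
  c : Cocone D
  pt_eq : c.pt = X
  isColimit : IsColimit c

/-- `K` is `M`-locally `κ`-generated, with witnessing set (of objects) `S`:
`K` is cocomplete, `(E, M)` is `κ`-convenient, `S` is a set of `κ`-generated objects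
w.r.t. `M`, and every object of `K` is a `κ`-directed colimit of objects from `S`
and morphisms from `M`. -/
structure IsLocallyGenerated (F : FactorizationSystem K) (κ : Cardinal.{v})
    (S : Set K) : Prop where
  hasColimits : HasColimits K
  convenient : Convenient F κ
  small : Small.{v} S
  gen : ∀ A ∈ S, IsGenerated F.M κ A
  presentation : ∀ X : K, Nonempty (DirectedColimitPresentation F.M κ S X)

/-- `K` is locally `κ`-presentable: cocomplete with a set `S` of `κ`-presentable objects
such that every object is a `κ`-directed colimit of objects from `S`. -/
def LocallyPresentable (K : Type u) [Category.{v} K] (κ : Cardinal.{v}) : Prop :=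
  HasColimits K ∧ ∃ S : Set K, Small.{v} S ∧
    (∀ A ∈ S, IsGenerated (⊤ : MorphismProperty K) κ A) ∧
    ∀ X : K, Nonempty (DirectedColimitPresentation (⊤ : MorphismProperty K) κ S X)


/-- The colimit of a λ-small diagram of λ-generated objects w.r.t. `M`
is again λ-generated w.r.t. `M`, provided it exists. -/
theorem generated_closed_under_small_colimits
    (F : FactorizationSystem K) (κ : Cardinal.{v}) (hκ : κ.IsRegular)
    (J : Type v) [SmallCategory J] (hJ : IsCardinalSmall J κ)
    (D : J ⥤ K) (hD : ∀ j : J, IsGenerated F.M κ (D.obj j))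
    (c : Cocone D) (hc : IsColimit c) :
    IsGenerated F.M κ c.pt := by
  intro I _ hI X hX cX hcX
  have : Fact κ.IsRegular := ⟨hκ⟩
  have : IsCardinalFiltered I κ := isCardinalFiltered_preorder I κ (fun T s hT ↦ by
    obtain ⟨i, hi⟩ := hI (Set.range s) (lt_of_le_of_lt Cardinal.mk_range_le hT)
    exact ⟨i, fun k ↦ hi _ ⟨k, rfl⟩⟩)
  have hArr : HasCardinalLT (Arrow J) κ := by
    rw [hasCardinalLT_iff_cardinal_mk_lt]
    refine lt_of_le_of_lt (Cardinal.mk_le_of_injective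
      (f := fun f : Arrow J ↦ (⟨f.left, f.right, f.hom⟩ : Σ (a : J) (b : J), a ⟶ b)) ?_) hJ
    rintro ⟨a, b, f⟩ ⟨a', b', f'⟩ h
    cases h
    rfl
  exact ⟨Functor.Accessible.Limits.isColimitMapCocone (F := D.op ⋙ coyoneda)
    (coyoneda.mapCone c.op)
    (fun Y ↦ isLimitOfPreserves ((evaluation K (Type v)).obj Y)
      (isLimitOfPreserves coyoneda hc.op)) κ (by simpa using hArr) cX
    (fun k ↦ (hD k.unop I hI X hX cX hcX).some)⟩

end LocallyGen
end

section
/- Let K be an M-locally λ-generated category, and let E_λ denote the class of E-morphisms whose domain and codomain are λ-generated w.r.t. M. Then M equals (E_λ)^⊥, the class of morphisms having the unique right lifting property with respect to every morphism in E_λ. -/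
open CategoryTheory CategoryTheory.Limits Opposite

universe w v u u₂

namespace LocallyGen

variable {K : Type u} [Category.{v} K]

theorem CardinalDirected.isFiltered {κ : Cardinal.{w}} (hκ : κ.IsRegular) {I : Type w}
    [Preorder I] (hI : CardinalDirected I κ) : IsFiltered I := by
  have hne : Nonempty I := by
    obtain ⟨i, _⟩ := hI ∅ (by
      rw [Cardinal.mk_eq_zero]
      exact lt_of_lt_of_le Cardinal.aleph0_pos hκ.aleph0_le)
    exact ⟨i⟩
  have hd : IsDirectedOrder I := ⟨fun a b => by
    obtain ⟨i, hi⟩ := hI {a, b} (lt_of_lt_of_le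
      (Cardinal.lt_aleph0_iff_set_finite.2 (Set.toFinite _)) hκ.aleph0_le)
    exact ⟨i, hi a (by simp), hi b (by simp)⟩⟩
  infer_instance

/-- `E`-quotients of generated objects are generated. -/
theorem IsGenerated.quotient {F : FactorizationSystem K} {κ : Cardinal.{v}}
    (hκ : κ.IsRegular) (hF : Convenient F κ) {A B : K} (e : A ⟶ B) (he : F.E e)
    (hA : IsGenerated F.M κ A) : IsGenerated F.M κ B := by
  intro I _ hI D hD c hc
  have := hI.isFiltered hκ
  obtain ⟨hAc⟩ := hA I hI D hD c hc
  have hM := hF.M_cocone I hI D hD c hc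
  refine ⟨Types.FilteredColimit.isColimitOf _ _ ?_ ?_⟩
  · intro (x : B ⟶ c.pt)
    obtain ⟨i, (y : A ⟶ D.obj i), hy⟩ := Types.jointly_surjective_of_isColimit hAc (e ≫ x)
    have hy : y ≫ c.ι.app i = e ≫ x := hy
    obtain ⟨d, ⟨_, hd⟩, _⟩ := F.orth e (c.ι.app i) he (hM i) y x hy
    exact ⟨i, d, hd.symm⟩
  · intro i j (f : B ⟶ D.obj i) (g : B ⟶ D.obj j) hfg
    have hfg : f ≫ c.ι.app i = g ≫ c.ι.app j := hfg
    obtain ⟨k, a, b, hab⟩ := (Types.FilteredColimit.isColimit_eq_iff _ hAc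
      (xi := (e ≫ f : A ⟶ D.obj i)) (xj := (e ≫ g : A ⟶ D.obj j))).1 (by
        change (e ≫ f) ≫ c.ι.app i = (e ≫ g) ≫ c.ι.app j
        simp [hfg])
    have hab : (e ≫ f) ≫ D.map a = (e ≫ g) ≫ D.map b := hab
    refine ⟨k, a, b, ?_⟩
    change f ≫ D.map a = g ≫ D.map b
    refine (F.orth e (c.ι.app k) he (hM k) ((e ≫ f) ≫ D.map a) (f ≫ c.ι.app i)
      (by simp)).unique ⟨by simp, by simp⟩ ⟨by simp [hab], by simp [hfg]⟩

/-- Left cancellation for the right class. -/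
theorem FactorizationSystem.M_cancel (F : FactorizationSystem K) {A B C : K} (f : A ⟶ B)
    (g : B ⟶ C) (hfg : F.M (f ≫ g)) (hg : F.M g) : F.M f := by
  obtain ⟨Z, e, m, he, hm, rfl⟩ := F.factor f
  obtain ⟨d, ⟨h1, h2⟩, _⟩ := F.orth e _ he hfg (𝟙 A) (m ≫ g) (by simp)
  have h3 : d ≫ e = 𝟙 Z := by
    refine (F.orth e (m ≫ g) he (F.M_comp _ _ hm hg) e (m ≫ g) rfl).unique
      ⟨by rw [← Category.assoc, h1, Category.id_comp], by simpa using h2⟩ ⟨by simp, by simp⟩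
  exact F.M_comp _ _ (F.M_iso e ⟨d, h1, h3⟩) hm

/-- An `E`-morphism out of a `κ`-directed `M`-colimit, orthogonal to all `E`-morphisms out
of the objects of the diagram, is an isomorphism. -/
theorem isIso_of_lift {F : FactorizationSystem K} {κ : Cardinal.{v}} [HasColimits K]
    (hF : Convenient F κ) {I : Type v} [Preorder I] (hI : CardinalDirected I κ)
    (D : I ⥤ K) (c : Cocone D) (hc : IsColimit c) {Y : K}
    (e : c.pt ⟶ Y) (he : F.E e)
    (hl : ∀ (i : I) {B : K} (f : D.obj i ⟶ B), F.E f → UniqueLift f e) : IsIso e := by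
  choose B q m hq hm hqm using fun i => F.factor (c.ι.app i ≫ e)
  have hb : ∀ {i j : I} (a : i ⟶ j), ∃ b : B i ⟶ B j,
      q i ≫ b = D.map a ≫ q j ∧ b ≫ m j = m i := fun {i j} a =>
    (F.orth (q i) (m j) (hq i) (hm j) (D.map a ≫ q j) (m i) (by simp [hqm])).exists
  choose b hb1 hb2 using @hb
  have huniq : ∀ {i j : I} (s t : B i ⟶ B j), q i ≫ s = q i ≫ t → s ≫ m j = t ≫ m j →
      s = t := fun {i j} s t h1 h2 =>
    (F.orth (q i) (m j) (hq i) (hm j) (q i ≫ t) (t ≫ m j) (by simp)).unique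
      ⟨h1, h2⟩ ⟨rfl, rfl⟩
  let G : I ⥤ K :=
    { obj := B
      map := fun a => b a
      map_id := fun i => huniq _ _ (by simp [hb1]) (by simp [hb2])
      map_comp := fun {i j k} a a' => huniq _ _
        (by rw [hb1, ← Category.assoc, hb1, Category.assoc, hb1]; simp)
        (by simp [hb2]) }
  have hG : DiagramInM F.M G := fun i j a =>
    F.M_cancel (b (homOfLE a)) (m j) (by rw [hb2]; exact hm i) (hm j)
  choose d hd hdu using fun i => hl i (q i) (hq i) (c.ι.app i) (m i) (hqm i).symm
  have hnatY : ∀ ⦃i j : I⦄ (a : i ⟶ j), b a ≫ m j = m i ≫ 𝟙 Y := fun i j a => by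
    simp [hb2]
  let cY : Cocone G := { pt := Y, ι := { app := m, naturality := hnatY } }
  have hnatX : ∀ ⦃i j : I⦄ (a : i ⟶ j), b a ≫ d j = d i ≫ 𝟙 c.pt := fun i j a => by
    rw [Category.comp_id]
    refine hdu i _ ⟨?_, ?_⟩
    · rw [← Category.assoc, hb1, Category.assoc, (hd j).1, c.w]
    · rw [Category.assoc, (hd j).2, hb2]
  let cX : Cocone G := { pt := c.pt, ι := { app := d, naturality := hnatX } }
  let cC : Cocone D := { pt := colimit G, ι :=
    { app := fun i => q i ≫ colimit.ι G i
      naturality := fun i j a => by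
        have : b a ≫ colimit.ι G j = colimit.ι G i := colimit.w G a
        dsimp
        rw [Category.comp_id, ← Category.assoc, ← hb1, Category.assoc, this] } }
  let r : colimit G ⟶ Y := (colimit.isColimit G).desc cY
  let t : colimit G ⟶ c.pt := (colimit.isColimit G).desc cX
  let p : c.pt ⟶ colimit G := hc.desc cC
  have hr : F.M r := hF.M_desc I hI G hG _ _ cY hm
  have hιr : ∀ i, colimit.ι G i ≫ r = m i := fun i => (colimit.isColimit G).fac cY i
  have hιt : ∀ i, colimit.ι G i ≫ t = d i := fun i => (colimit.isColimit G).fac cX i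
  have hιp : ∀ i, c.ι.app i ≫ p = q i ≫ colimit.ι G i := fun i => hc.fac cC i
  have hpt : p ≫ t = 𝟙 c.pt := hc.hom_ext fun i => by
    rw [← Category.assoc, hιp, Category.assoc, hιt, (hd i).1, Category.comp_id]
  have hpr : p ≫ r = e := hc.hom_ext fun i => by
    rw [← Category.assoc, hιp, Category.assoc, hιr, hqm]
  have hte : t ≫ e = r := colimit.hom_ext fun i => by
    rw [← Category.assoc, hιt, hιr, (hd i).2]
  obtain ⟨s, ⟨hs1, hs2⟩, _⟩ := F.orth e r he hr p (𝟙 Y) (by simp [hpr])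
  exact ⟨s ≫ t, by rw [← Category.assoc, hs1, hpt], by rw [Category.assoc, hte, hs2]⟩

/-- If `K` is `M`-locally λ-generated then `M = (E_λ)^⊥`, where `E_λ`
is the class of `E`-morphisms with λ-generated domain and codomain. -/
theorem M_eq_perp_E_lambda
    (F : FactorizationSystem K) (κ : Cardinal.{v}) (hκ : κ.IsRegular)
    (S : Set K) (h : IsLocallyGenerated F κ S) :
    ∀ {X Y : K} (m : X ⟶ Y), F.M m ↔
      ∀ {A B : K} (e : A ⟶ B), F.E e → IsGenerated F.M κ A → IsGenerated F.M κ B →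
        UniqueLift e m := by
  intro X Y m
  refine ⟨fun hm A B e he _ _ => F.orth e m he hm, fun hl => ?_⟩
  obtain ⟨Z, e, n, he, hn, rfl⟩ := F.factor m
  have := h.hasColimits
  obtain ⟨⟨I, hI, D, hmem, hD, c, rfl, hc⟩⟩ := h.presentation X
  have : IsIso e := by
    refine isIso_of_lift h.convenient hI D c hc e he ?_
    intro i B f hf u v huv
    have hA := h.gen _ (hmem i)
    obtain ⟨d, ⟨hd1, hd2⟩, hdu⟩ := hl f hf hA (hA.quotient hκ h.convenient f hf) u (v ≫ n)
      (by rw [← Category.assoc, huv, Category.assoc])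
    refine ⟨d, ⟨hd1, ?_⟩, fun d' hd' => hdu d' ⟨hd'.1, by rw [← Category.assoc, hd'.2]⟩⟩
    exact (F.orth f n hf hn (u ≫ e) (v ≫ n) (by rw [huv, Category.assoc])).unique
      ⟨by rw [← Category.assoc, hd1], by simpa using hd2⟩ ⟨huv.symm, rfl⟩
  exact F.M_comp _ _ (F.M_iso e this) hn

end LocallyGen
end

section
/- Let K and L be M-locally λ-generated categories (each with its λ-convenient factorization system, both classes denoted M and E), and let R : K → L be a right adjoint functor that preserves M-morphisms and λ-directed colimits of M-morphisms. Then its left adjoint F : L → K maps objects of L that are λ-generated w.r.t. M to objects of K that are λ-generated w.r.t. M. -/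
open CategoryTheory CategoryTheory.Limits Opposite

universe w v u u₂

namespace LocallyGen

variable {K : Type u} [Category.{v} K]

/-- If `R : K ⥤ L` is a right adjoint between `M`-locally λ-generated
categories preserving `M`-morphisms and λ-directed colimits of `M`-morphisms, then its
left adjoint preserves λ-generated objects w.r.t. `M`. -/
theorem leftAdjoint_preserves_generated
    {L : Type u₂} [Category.{v} L]
    (FK : FactorizationSystem K) (FL : FactorizationSystem L)
    (κ : Cardinal.{v}) (hκ : κ.IsRegular)
    (SK : Set K) (SL : Set L)
    (hK : IsLocallyGenerated FK κ SK) (hL : IsLocallyGenerated FL κ SL)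
    (Fn : L ⥤ K) (R : K ⥤ L) (adj : Fn ⊣ R)
    (hRM : ∀ {X Y : K} (f : X ⟶ Y), FK.M f → FL.M (R.map f))
    (hRcolim : ∀ (I : Type v) [Preorder I], CardinalDirected I κ →
        ∀ (D : I ⥤ K), DiagramInM FK.M D → ∀ (c : Cocone D), IsColimit c →
          Nonempty (IsColimit (R.mapCocone c)))
    {A : L} (hA : IsGenerated FL.M κ A) :
    IsGenerated FK.M κ (Fn.obj A) := by
  intro I _ hI D hD c hc
  obtain ⟨h1⟩ := hRcolim I hI D hD c hc
  obtain ⟨h2⟩ := hA I hI (D ⋙ R) (fun i j h => hRM _ (hD h)) (R.mapCocone c) h1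
  have h3 : IsColimit ((R ⋙ coyoneda.obj (op A)).mapCocone c) := h2
  exact ⟨IsColimit.mapCoconeEquiv (adj.compCoyonedaIso.app (op A)).symm h3⟩

end LocallyGen
end

section
/- Let K be a metric space and (K_i)_{i∈I} a family of subsets of K indexed by a directed partial order I with K_i ⊆ K_j whenever i ≤ j, such that each K_i, with the induced metric, is a complete convex metric space, and such that the union ⋃_{i∈I} K_i is dense in K. Then for every pair of points x, y ∈ K and every ε > 0 there exist an index i ∈ I and points a, b ∈ K_i such that d(a,b) ≤ d(x,y), d(a,x) ≤ ε and d(b,y) ≤ ε. -/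
/-- A metric space is convex in the sense of Menger if between any two distinct points
there is a strictly intermediate point. -/
def MengerConvex (X : Type*) [MetricSpace X] : Prop :=
  ∀ x y : X, x ≠ y → ∃ z : X, z ≠ x ∧ z ≠ y ∧ dist x z + dist z y = dist x y

open Filter Topology in
/-- A form of Ekeland's variational principle for continuous nonnegative functions. -/
theorem ekeland_aux {X : Type*} [MetricSpace X] [CompleteSpace X] (x0 : X) (φ : X → ℝ)
    (hφ : Continuous φ) (h0 : ∀ x, 0 ≤ φ x) :
    ∃ x, ∀ y, dist x y + φ y ≤ φ x → y = x := by
  have step : ∀ x, ∃ z, dist x z + φ z ≤ φ x ∧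
      ∀ y, dist x y + φ y ≤ φ x → 2 * φ z ≤ φ x + φ y := by
    intro x
    by_contra! hcon
    set S : Set ℝ := φ '' {y | dist x y + φ y ≤ φ x} with hS
    have hne : S.Nonempty := ⟨φ x, x, by simp, rfl⟩
    have hbdd : BddBelow S := ⟨0, by rintro _ ⟨y, _, rfl⟩; exact h0 y⟩
    obtain ⟨y, hy, hxy⟩ := hcon x (by simp)
    have hlt : sInf S < (φ x + sInf S) / 2 := by
      have := csInf_le hbdd (⟨y, hy, rfl⟩ : φ y ∈ S)
      linarith
    obtain ⟨_, ⟨z, hz, rfl⟩, hzlt⟩ := exists_lt_of_csInf_lt hne hlt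
    obtain ⟨w, hw, hwz⟩ := hcon z hz
    have := csInf_le hbdd (⟨w, hw, rfl⟩ : φ w ∈ S)
    linarith
  choose f hf1 hf2 using step
  set u : ℕ → X := fun n => f^[n] x0 with hu
  have hsucc : ∀ n, u (n + 1) = f (u n) := fun n => Function.iterate_succ_apply' f n x0
  have hstep : ∀ n m, n ≤ m → dist (u n) (u m) + φ (u m) ≤ φ (u n) := by
    intro n m hnm
    induction m, hnm using Nat.le_induction with
    | base => simp
    | succ m _ ih =>
      have h1 := hf1 (u m)
      rw [← hsucc] at h1
      have := dist_triangle (u n) (u m) (u (m + 1))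
      linarith
  have hanti : Antitone (fun n => φ (u n)) := by
    intro n m hnm
    have := hstep n m hnm
    have := dist_nonneg (x := u n) (y := u m)
    show φ (u m) ≤ φ (u n)
    linarith
  have hb : BddBelow (Set.range fun n => φ (u n)) := ⟨0, by rintro _ ⟨n, rfl⟩; exact h0 _⟩
  have hlim := tendsto_atTop_ciInf hanti hb
  set L := ⨅ n, φ (u n) with hL
  have hc : CauchySeq u := by
    refine cauchySeq_of_le_tendsto_0' (fun n => φ (u n) - L) ?_ ?_
    · intro n m hnm
      have h1 := hstep n m hnm
      have h2 : L ≤ φ (u m) := ciInf_le hb m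
      linarith
    · simpa using hlim.sub_const L
  obtain ⟨x, hx⟩ := cauchySeq_tendsto_of_complete hc
  have hxL : φ x = L := tendsto_nhds_unique ((hφ.tendsto x).comp hx) hlim
  have hxn : ∀ n, dist (u n) x + φ x ≤ φ (u n) := by
    intro n
    refine le_of_tendsto ((tendsto_const_nhds.dist hx).add ((hφ.tendsto x).comp hx)) ?_
    filter_upwards [eventually_ge_atTop n] with m hm using hstep n m hm
  refine ⟨x, fun y hy => ?_⟩
  have key : ∀ n, 2 * φ (u (n + 1)) ≤ φ (u n) + φ y := by
    intro n
    rw [hsucc]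
    apply hf2
    have := hxn n
    have := dist_triangle (u n) x y
    linarith
  have hle : 2 * L ≤ L + φ y :=
    le_of_tendsto_of_tendsto' (((tendsto_add_atTop_iff_nat 1).2 hlim).const_mul 2)
      (hlim.add_const (φ y)) key
  have : dist x y ≤ 0 := by linarith
  exact (dist_le_zero.1 this).symm

/-- Menger: points at prescribed distance exist between two points. -/
theorem menger_aux {X : Type*} [MetricSpace X] [CompleteSpace X] (hX : MengerConvex X)
    (p q : X) (t : ℝ) (ht0 : 0 ≤ t) (ht : t ≤ dist p q) :
    ∃ z, dist p z ≤ t ∧ dist z q ≤ dist p q - t := by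
  set A : Set (X × X) := {a | dist p a.1 + dist a.1 a.2 + dist a.2 q = dist p q ∧
    dist p a.1 ≤ t ∧ dist a.2 q ≤ dist p q - t} with hA
  have hcl : IsClosed A := by
    have c1 : IsClosed {a : X × X | dist p a.1 + dist a.1 a.2 + dist a.2 q = dist p q} :=
      isClosed_eq (by fun_prop) (by fun_prop)
    have c2 : IsClosed {a : X × X | dist p a.1 ≤ t} :=
      isClosed_le (by fun_prop) (by fun_prop)
    have c3 : IsClosed {a : X × X | dist a.2 q ≤ dist p q - t} :=
      isClosed_le (by fun_prop) (by fun_prop)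
    exact c1.inter (c2.inter c3)
  have : CompleteSpace A := hcl.completeSpace_coe
  obtain ⟨⟨⟨z, w⟩, hzw, hz, hw⟩, hmax⟩ := ekeland_aux
    (⟨(p, q), by simp, by simpa using ht0, by simpa using ht⟩ : A)
    (fun a => dist a.1.1 a.1.2) (by fun_prop) (fun _ => dist_nonneg)
  simp only at hzw hz hw
  by_cases h : z = w
  · subst h
    exact ⟨z, hz, hw⟩
  exfalso
  obtain ⟨v, hvz, hvw, hv⟩ := hX z w h
  have t1 := dist_triangle p z v
  have t2 := dist_triangle v w q
  have t3 := dist_triangle p v q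
  rcases le_total (dist p v) t with hc | hc
  · have := hmax ⟨(v, w), by
      have := dist_triangle v w q
      show dist p v + dist v w + dist w q = dist p q
      linarith, hc, hw⟩ (by
        simp only [Subtype.dist_eq, Prod.dist_eq, dist_self]
        rw [max_eq_left dist_nonneg]
        exact hv.le)
    simp only [Subtype.mk.injEq, Prod.mk.injEq] at this
    exact hvz this.1
  · have := hmax ⟨(z, v), by
      show dist p z + dist z v + dist v q = dist p q
      linarith, hz, by
      show dist v q ≤ dist p q - t
      linarith⟩ (by
        simp only [Subtype.dist_eq, Prod.dist_eq, dist_self]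
        rw [max_eq_right dist_nonneg, dist_comm w v]
        linarith)
    simp only [Subtype.mk.injEq, Prod.mk.injEq] at this
    exact hvw this.2

/-- Let `K` be a metric space and `(K i)` a monotone family of subsets
of `K` indexed by a directed partial order such that each `K i`, with the induced
metric, is a complete convex metric space, and such that `⋃ i, K i` is dense in `K`.
Then for all `x y ∈ K` and `ε > 0` there are `i` and `a, b ∈ K i` with
`d(a,b) ≤ d(x,y)`, `d(a,x) ≤ ε` and `d(b,y) ≤ ε`. -/
theorem approx_pair_in_directed_union_of_convex_complete
    {K : Type*} [MetricSpace K] {I : Type*} [PartialOrder I] [IsDirected I (· ≤ ·)]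
    (Ki : I → Set K)
    (hmono : ∀ {i j : I}, i ≤ j → Ki i ⊆ Ki j)
    (hcomplete : ∀ i : I, IsComplete (Ki i))
    (hconvex : ∀ i : I, MengerConvex (Ki i))
    (hdense : Dense (⋃ i : I, Ki i))
    (x y : K) (ε : ℝ) (hε : 0 < ε) :
    ∃ (i : I) (a b : K), a ∈ Ki i ∧ b ∈ Ki i ∧
      dist a b ≤ dist x y ∧ dist a x ≤ ε ∧ dist b y ≤ ε := by
  obtain ⟨a, ha, hxa⟩ := Metric.dense_iff.1 hdense x (ε / 3) (by positivity)
  obtain ⟨b, hb, hyb⟩ := Metric.dense_iff.1 hdense y (ε / 3) (by positivity)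
  rw [Metric.mem_ball] at ha hb
  obtain ⟨i, hi⟩ := Set.mem_iUnion.1 hxa
  obtain ⟨j, hj⟩ := Set.mem_iUnion.1 hyb
  obtain ⟨k, hik, hjk⟩ := exists_ge_ge i j
  have hak := hmono hik hi
  have hbk := hmono hjk hj
  by_cases hd : dist a b ≤ dist x y
  · exact ⟨k, a, b, hak, hbk, hd, by linarith, by linarith⟩
  have : CompleteSpace (Ki k) := (hcomplete k).completeSpace_coe
  obtain ⟨⟨z, hzk⟩, hz1, hz2⟩ := menger_aux (hconvex k) ⟨a, hak⟩ ⟨b, hbk⟩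
    (dist a b - dist x y) (by linarith) (by
      have := dist_nonneg (x := x) (y := y)
      simp only [Subtype.dist_eq]
      linarith)
  simp only [Subtype.dist_eq] at hz1 hz2
  have h1 := dist_triangle4 a x y b
  have h2 := dist_triangle z a x
  rw [dist_comm z a] at h2
  rw [dist_comm y b] at h1
  exact ⟨k, z, b, hzk, hbk, by linarith, by linarith, by linarith⟩
end

section
/- Let A, B, C be real Banach spaces, let f : A → B and g : A → C be continuous linear maps with ‖f‖ ≤ 1 and ‖g‖ ≤ 1, and let ε > 0. Define, for (x,y) ∈ B × C, ‖(x,y)‖_ε = inf{ ‖b‖ + ‖c‖ + ε‖a‖ : a ∈ A, b ∈ B, c ∈ C, x = b + f(a), y = c − g(a) }. Then ‖·‖_ε is a norm on B × C equivalent to the product norm (so that B × C equipped with ‖·‖_ε is again a Banach space); the canonical injections b ↦ (b,0) and c ↦ (0,c) have norm at most 1 with respect to ‖·‖_ε; and for every a ∈ A one has ‖(f(a), −g(a))‖_ε ≤ ε‖a‖, i.e. the square formed by f, g and the two injections commutes up to ε. -/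
/-- The ε-pushout norm on `B × C`.  For Banach spaces `A B C`,
contractive maps `f : A → B`, `g : A → C` and `ε > 0`, define
`‖(x,y)‖_ε = inf { ‖b‖ + ‖c‖ + ε‖a‖ : x = b + f a, y = c - g a }`.
Then `‖·‖_ε` is a norm on `B × C`, equivalent to the product norm (hence `B × C` with
this norm is again a Banach space); the two canonical injections have norm `≤ 1` for
this norm; and `‖(f a, -g a)‖_ε ≤ ε ‖a‖` for every `a : A`, i.e. the square formed by
`f`, `g` and the injections commutes up to `ε`. -/
theorem epsilon_pushout_norm
    {A B C : Type*}
    [NormedAddCommGroup A] [NormedSpace ℝ A] [CompleteSpace A]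
    [NormedAddCommGroup B] [NormedSpace ℝ B] [CompleteSpace B]
    [NormedAddCommGroup C] [NormedSpace ℝ C] [CompleteSpace C]
    (f : A →L[ℝ] B) (g : A →L[ℝ] C) (hf : ‖f‖ ≤ 1) (hg : ‖g‖ ≤ 1)
    (ε : ℝ) (hε : 0 < ε)
    (N : B × C → ℝ)
    (hN : ∀ p : B × C, N p = sInf {r : ℝ | ∃ (a : A) (b : B) (c : C),
        p.1 = b + f a ∧ p.2 = c - g a ∧ r = ‖b‖ + ‖c‖ + ε * ‖a‖}) :
    (∀ p : B × C, 0 ≤ N p) ∧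
    (∀ p : B × C, N p = 0 ↔ p = 0) ∧
    (∀ p q : B × C, N (p + q) ≤ N p + N q) ∧
    (∀ (t : ℝ) (p : B × C), N (t • p) = |t| * N p) ∧
    (∃ c₁ c₂ : ℝ, 0 < c₁ ∧ 0 < c₂ ∧ ∀ p : B × C,
        c₁ * max ‖p.1‖ ‖p.2‖ ≤ N p ∧ N p ≤ c₂ * max ‖p.1‖ ‖p.2‖) ∧
    (∀ b : B, N (b, 0) ≤ ‖b‖) ∧
    (∀ c : C, N (0, c) ≤ ‖c‖) ∧
    (∀ a : A, N (f a, -(g a)) ≤ ε * ‖a‖) := by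
  have up : ∀ (p : B × C) (a : A) (b : B) (c : C), p.1 = b + f a → p.2 = c - g a →
      N p ≤ ‖b‖ + ‖c‖ + ε * ‖a‖ := by
    intro p a b c h1 h2
    rw [hN]
    refine csInf_le ⟨0, ?_⟩ ⟨a, b, c, h1, h2, rfl⟩
    rintro r ⟨a, b, c, -, -, rfl⟩
    positivity
  have lo : ∀ (p : B × C) (r : ℝ), (∀ (a : A) (b : B) (c : C), p.1 = b + f a → p.2 = c - g a →
      r ≤ ‖b‖ + ‖c‖ + ε * ‖a‖) → r ≤ N p := by
    intro p r h
    rw [hN]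
    refine le_csInf ⟨_, 0, p.1, p.2, by simp, by simp, rfl⟩ ?_
    rintro _ ⟨a, b, c, h1, h2, rfl⟩
    exact h a b c h1 h2
  have nonneg : ∀ p, 0 ≤ N p := fun p => lo p 0 (fun a b c _ _ => by positivity)
  have upper : ∀ p : B × C, N p ≤ ‖p.1‖ + ‖p.2‖ := by
    intro p
    simpa using up p 0 p.1 p.2 (by simp) (by simp)
  have hm : 0 < min 1 ε := lt_min one_pos hε
  have key : ∀ p : B × C, min 1 ε * max ‖p.1‖ ‖p.2‖ ≤ N p := by
    intro p
    apply lo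
    intro a b c h1 h2
    have hfa : ‖f a‖ ≤ ‖a‖ := by simpa using f.le_of_opNorm_le hf a
    have hga : ‖g a‖ ≤ ‖a‖ := by simpa using g.le_of_opNorm_le hg a
    have e1 : ‖p.1‖ ≤ ‖b‖ + ‖a‖ := by
      rw [h1]; exact (norm_add_le _ _).trans (by linarith)
    have e2 : ‖p.2‖ ≤ ‖c‖ + ‖a‖ := by
      rw [h2]; exact (norm_sub_le _ _).trans (by linarith)
    have e3 : max ‖p.1‖ ‖p.2‖ ≤ (‖b‖ + ‖c‖) + ‖a‖ :=
      max_le (by linarith [norm_nonneg c]) (by linarith [norm_nonneg b])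
    calc min 1 ε * max ‖p.1‖ ‖p.2‖ ≤ min 1 ε * ((‖b‖ + ‖c‖) + ‖a‖) := by gcongr
      _ = min 1 ε * (‖b‖ + ‖c‖) + min 1 ε * ‖a‖ := by ring
      _ ≤ 1 * (‖b‖ + ‖c‖) + ε * ‖a‖ := by
        gcongr
        · exact min_le_left _ _
        · exact min_le_right _ _
      _ = _ := by ring
  have zero : N 0 = 0 := le_antisymm (by simpa using upper 0) (nonneg 0)
  have smul_le : ∀ (t : ℝ) (p : B × C), N (t • p) ≤ |t| * N p := by
    intro t p
    rcases eq_or_ne t 0 with rfl | ht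
    · simp [zero]
    have ht' : 0 < |t| := abs_pos.mpr ht
    rw [← div_le_iff₀' ht']
    apply lo
    intro a b c h1 h2
    rw [div_le_iff₀' ht']
    have := up (t • p) (t • a) (t • b) (t • c) (by simp [h1]) (by simp [h2, smul_sub])
    simp only [norm_smul, Real.norm_eq_abs] at this
    linarith
  refine ⟨nonneg, ?_, ?_, ?_, ⟨min 1 ε, 2, hm, two_pos, fun p => ⟨key p, ?_⟩⟩, ?_, ?_, ?_⟩
  · intro p
    refine ⟨fun h => ?_, fun h => h ▸ zero⟩
    have h1 := key p
    rw [h] at h1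
    have h2 : max ‖p.1‖ ‖p.2‖ ≤ 0 := by
      by_contra hc
      push Not at hc
      have := mul_pos hm hc
      linarith
    exact norm_le_zero_iff.mp h2
  · intro p q
    suffices N (p + q) - N q ≤ N p by linarith
    apply lo
    intro a b c h1 h2
    suffices N (p + q) - (‖b‖ + ‖c‖ + ε * ‖a‖) ≤ N q by linarith
    apply lo
    intro a' b' c' h1' h2'
    have h := up (p + q) (a + a') (b + b') (c + c')
      (by simp only [Prod.fst_add, h1, h1', map_add]; abel)
      (by simp only [Prod.snd_add, h2, h2', map_add]; abel)
    have := mul_le_mul_of_nonneg_left (norm_add_le a a') hε.le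
    linarith [norm_add_le b b', norm_add_le c c']
  · intro t p
    refine le_antisymm (smul_le t p) ?_
    rcases eq_or_ne t 0 with rfl | ht
    · simp [zero]
    have h := smul_le t⁻¹ (t • p)
    rw [inv_smul_smul₀ ht, abs_inv] at h
    rwa [← le_inv_mul_iff₀ (abs_pos.mpr ht)]
  · linarith [upper p, le_max_left ‖p.1‖ ‖p.2‖, le_max_right ‖p.1‖ ‖p.2‖]
  · intro b
    simpa using upper (b, 0)
  · intro c
    simpa using upper (0, c)
  · intro a
    simpa using up (f a, -(g a)) a 0 0 (by simp) (by simp)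
end

section
/- Let A, B, C, D be real Banach spaces, f : A → B and g : A → C continuous linear maps with ‖f‖ ≤ 1, ‖g‖ ≤ 1, and ε > 0; let ‖(x,y)‖_ε = inf{ ‖b‖ + ‖c‖ + ε‖a‖ : x = b + f(a), y = c − g(a) } be the corresponding norm on B × C. If u : B → D and v : C → D are continuous linear maps with ‖u‖ ≤ 1, ‖v‖ ≤ 1 and ‖u∘f − v∘g‖ ≤ ε, then the linear map w : B × C → D defined by w(x,y) = u(x) + v(y) satisfies ‖w(x,y)‖ ≤ ‖(x,y)‖_ε for all (x,y) ∈ B × C; moreover w is the unique linear map with w(b,0) = u(b) for all b ∈ B and w(0,c) = v(c) for all c ∈ C. -/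
/-- Universal property of the ε-pushout norm.  With
`‖(x,y)‖_ε = inf { ‖b‖ + ‖c‖ + ε‖a‖ : x = b + f a, y = c - g a }` on `B × C`,
if `u : B → D` and `v : C → D` are contractive linear maps with
`‖u (f a) - v (g a)‖ ≤ ε ‖a‖` for all `a`, then the linear map
`w (x, y) = u x + v y` satisfies `‖w p‖ ≤ ‖p‖_ε` for all `p`, and `w` is the unique
linear map restricting to `u` and `v` on the two summands. -/
theorem epsilon_pushout_universal_property
    {A B C D : Type*}
    [NormedAddCommGroup A] [NormedSpace ℝ A] [CompleteSpace A]
    [NormedAddCommGroup B] [NormedSpace ℝ B] [CompleteSpace B]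
    [NormedAddCommGroup C] [NormedSpace ℝ C] [CompleteSpace C]
    [NormedAddCommGroup D] [NormedSpace ℝ D] [CompleteSpace D]
    (f : A →L[ℝ] B) (g : A →L[ℝ] C) (hf : ‖f‖ ≤ 1) (hg : ‖g‖ ≤ 1)
    (ε : ℝ) (hε : 0 < ε)
    (N : B × C → ℝ)
    (hN : ∀ p : B × C, N p = sInf {r : ℝ | ∃ (a : A) (b : B) (c : C),
        p.1 = b + f a ∧ p.2 = c - g a ∧ r = ‖b‖ + ‖c‖ + ε * ‖a‖})
    (u : B →L[ℝ] D) (v : C →L[ℝ] D) (hu : ‖u‖ ≤ 1) (hv : ‖v‖ ≤ 1)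
    (hcomm : ∀ a : A, ‖u (f a) - v (g a)‖ ≤ ε * ‖a‖) :
    (∀ p : B × C, ‖u p.1 + v p.2‖ ≤ N p) ∧
    (∀ w : B × C →ₗ[ℝ] D, (∀ b : B, w (b, 0) = u b) → (∀ c : C, w (0, c) = v c) →
        ∀ p : B × C, w p = u p.1 + v p.2) := by
  refine ⟨fun p => ?_, fun w hb hc p => ?_⟩
  · rw [hN p]
    apply le_csInf
    · exact ⟨_, 0, p.1, p.2, by simp, by simp, rfl⟩
    · rintro r ⟨a, b, c, h1, h2, rfl⟩
      have e : u p.1 + v p.2 = u b + v c + (u (f a) - v (g a)) := by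
        rw [h1, h2, map_add, map_sub]
        abel
      have hub : ‖u b‖ ≤ ‖b‖ := by simpa using u.le_of_opNorm_le hu b
      have hvc : ‖v c‖ ≤ ‖c‖ := by simpa using v.le_of_opNorm_le hv c
      rw [e]
      exact (norm_add₃_le).trans (add_le_add (add_le_add hub hvc) (hcomm a))
  · have e : p = (p.1, 0) + (0, p.2) := by simp
    rw [← hb, ← hc, ← map_add, ← e]
end

section
/- Let K be an M-locally λ-generated category. Then in K, λ-small limits commute with λ-directed colimits of M-morphisms: for every λ-small category J, every λ-directed poset I, and every diagram D : J × I → K such that for each j ∈ J and i ≤ i' in I the morphism D(j,i) → D(j,i') lies in M, the canonical morphism colim_{i∈I} lim_{j∈J} D(j,i) → lim_{j∈J} colim_{i∈I} D(j,i) is an isomorphism. -/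
open CategoryTheory CategoryTheory.Limits Opposite

universe w v u u₂

namespace LocallyGen

variable {K : Type u} [Category.{v} K]

theorem M_of_lift (F : FactorizationSystem K) {X Y : K} (f : X ⟶ Y)
    (hf : ∀ {A B : K} (e : A ⟶ B), F.E e → UniqueLift e f) : F.M f := by
  obtain ⟨C, e, m, he, hm, hem⟩ := F.factor f
  obtain ⟨d, ⟨hd1, hd2⟩, -⟩ := hf e he (𝟙 X) m (by simp [hem])
  obtain ⟨d', -, hu⟩ := F.orth e m he hm e m rfl
  have h1 : d ≫ e = d' := hu _ ⟨by rw [← Category.assoc, hd1, Category.id_comp],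
    by rw [Category.assoc, hem, hd2]⟩
  have h2 : 𝟙 C = d' := hu _ ⟨by simp, by simp⟩
  have hi : IsIso e := ⟨d, hd1, by rw [h1, h2]⟩
  rw [← hem]
  exact F.M_comp _ _ (F.M_iso _ hi) hm

theorem M_limMap (F : FactorizationSystem K) {J : Type v} [SmallCategory J] [HasLimits K]
    {G H : J ⥤ K} (α : G ⟶ H) (hα : ∀ j, F.M (α.app j)) : F.M (limMap α) := by
  apply M_of_lift F
  intro A B e he u w huw
  have hsq : ∀ j, (u ≫ limit.π G j) ≫ α.app j = e ≫ (w ≫ limit.π H j) := by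
    intro j
    rw [Category.assoc, ← limMap_π, ← Category.assoc, huw, Category.assoc]
  choose d hd hu using fun j => F.orth e (α.app j) he (hα j) _ _ (hsq j)
  have hnat : ∀ {j j' : J} (f : j ⟶ j'), d j ≫ G.map f = d j' := by
    intro j j' f
    refine hu j' _ ⟨?_, ?_⟩
    · rw [← Category.assoc, (hd j).1, Category.assoc, limit.w]
    · rw [Category.assoc, α.naturality, ← Category.assoc, (hd j).2, Category.assoc, limit.w]
  let c : Cone G :=
    { pt := B
      π := { app := d
             naturality := fun j j' f => by
               dsimp
               rw [Category.id_comp, hnat] } }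
  have hc : ∀ j, limit.lift G c ≫ limit.π G j = d j := fun j => limit.lift_π c j
  refine ⟨limit.lift G c, ⟨?_, ?_⟩, ?_⟩
  · refine limit.hom_ext fun j => ?_
    rw [Category.assoc, hc, (hd j).1]
  · refine limit.hom_ext fun j => ?_
    rw [Category.assoc, limMap_π, ← Category.assoc, hc, (hd j).2]
  · rintro y ⟨hy1, hy2⟩
    refine limit.hom_ext fun j => ?_
    rw [hc]
    refine hu j _ ⟨?_, ?_⟩
    · rw [← Category.assoc, hy1]
    · rw [Category.assoc, ← limMap_π, ← Category.assoc, hy2]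

theorem exists_bound {I : Type v} [Preorder I] {κ : Cardinal.{v}} (hI : CardinalDirected I κ)
    {T : Type v} (hT : Cardinal.mk T < κ) (f : T → I) : ∃ i, ∀ t, f t ≤ i := by
  obtain ⟨i, hi⟩ := hI (Set.range f) (lt_of_le_of_lt Cardinal.mk_range_le hT)
  exact ⟨i, fun t => hi _ ⟨t, rfl⟩⟩

theorem exists_bound₂ {I : Type v} [Preorder I] {κ : Cardinal.{v}} (hκ : κ.IsRegular)
    (hI : CardinalDirected I κ) (a b : I) : ∃ i, a ≤ i ∧ b ≤ i := by
  obtain ⟨i, hi⟩ := hI {a, b}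
    (lt_of_lt_of_le (Cardinal.lt_aleph0_of_finite _) hκ.aleph0_le)
  exact ⟨i, hi a (by simp), hi b (by simp)⟩

theorem isFiltered_of_directed {I : Type v} [Preorder I] {κ : Cardinal.{v}} (hκ : κ.IsRegular)
    (hI : CardinalDirected I κ) : IsFiltered I := by
  have : IsDirectedOrder I := ⟨fun a b => exists_bound₂ hκ hI a b⟩
  have : Nonempty I := by
    obtain ⟨i, -⟩ := hI ∅ (by simpa using hκ.pos)
    exact ⟨i⟩
  infer_instance

theorem gen_factor {M : MorphismProperty K} {κ : Cardinal.{v}} {A : K} (hA : IsGenerated M κ A)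
    {I : Type v} [Preorder I] (hI : CardinalDirected I κ) {D : I ⥤ K} (hD : DiagramInM M D)
    {c : Cocone D} (hc : IsColimit c) (x : A ⟶ c.pt) :
    ∃ (i : I) (a : A ⟶ D.obj i), a ≫ c.ι.app i = x := by
  obtain ⟨h⟩ := hA I hI D hD c hc
  obtain ⟨i, a, ha⟩ := Types.jointly_surjective_of_isColimit h x
  exact ⟨i, a, ha⟩

theorem gen_eq {M : MorphismProperty K} {κ : Cardinal.{v}} (hκ : κ.IsRegular)
    {A : K} (hA : IsGenerated M κ A)
    {I : Type v} [Preorder I] (hI : CardinalDirected I κ) {D : I ⥤ K} (hD : DiagramInM M D)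
    {c : Cocone D} (hc : IsColimit c) {i : I} (a b : A ⟶ D.obj i)
    (hab : a ≫ c.ι.app i = b ≫ c.ι.app i) :
    ∃ (k : I) (hk : i ≤ k), a ≫ D.map (homOfLE hk) = b ≫ D.map (homOfLE hk) := by
  obtain ⟨h⟩ := hA I hI D hD c hc
  have := isFiltered_of_directed hκ hI
  obtain ⟨k, f, hk⟩ := (Types.FilteredColimit.isColimit_eq_iff' h a b).1 hab
  exact ⟨k, leOfHom f, hk⟩

/-- A morphism that is seen as an isomorphism by all objects of `S` is an isomorphism. -/
theorem isIso_of_S {M : MorphismProperty K} {κ : Cardinal.{v}} {S : Set K}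
    (hS : ∀ X : K, Nonempty (DirectedColimitPresentation M κ S X)) {X Y : K} (φ : X ⟶ Y)
    (hinj : ∀ A ∈ S, ∀ x y : A ⟶ X, x ≫ φ = y ≫ φ → x = y)
    (hsurj : ∀ A ∈ S, ∀ y : A ⟶ Y, ∃ x : A ⟶ X, x ≫ φ = y) : IsIso φ := by
  have hmono : ∀ {Z : K} (x y : Z ⟶ X), x ≫ φ = y ≫ φ → x = y := by
    intro Z x y hxy
    obtain ⟨P⟩ := hS Z
    obtain ⟨I, hdir, D, hmem, hM, c, hpt, hc⟩ := P
    subst hpt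
    refine hc.hom_ext fun i => hinj _ (hmem i) _ _ ?_
    rw [Category.assoc, hxy, Category.assoc]
  obtain ⟨P⟩ := hS Y
  obtain ⟨I, hdir, D, hmem, hM, c, hpt, hc⟩ := P
  subst hpt
  choose s hs using fun i => hsurj _ (hmem i) (c.ι.app i)
  let c' : Cocone D :=
    { pt := X
      ι := { app := s
             naturality := fun i i' f => by
               apply hmono
               dsimp
               rw [Category.comp_id, Category.assoc, hs, hs, c.w] } }
  have hsec : hc.desc c' ≫ φ = 𝟙 _ := by
    refine hc.hom_ext fun i => ?_
    rw [← Category.assoc, hc.fac]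
    simpa [c'] using hs i
  refine ⟨hc.desc c', ?_, hsec⟩
  apply hmono
  rw [Category.assoc, hsec, Category.comp_id, Category.id_comp]

/-- In an `M`-locally λ-generated category, λ-small limits commute
with λ-directed colimits of `M`-morphisms: for every λ-small category `J`, λ-directed
poset `I` and diagram `D : J × I ⥤ K` whose connecting morphisms in the `I`-direction
lie in `M`, the canonical comparison morphism
`colim_i lim_j D(j,i) ⟶ lim_j colim_i D(j,i)` is an isomorphism. -/
theorem small_limits_commute_with_directed_colimits_of_M
    (F : FactorizationSystem K) (κ : Cardinal.{v}) (hκ : κ.IsRegular)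
    (S : Set K) (h : IsLocallyGenerated F κ S)
    [HasLimits K] [HasColimits K]
    (J : Type v) [SmallCategory J] (hJ : IsCardinalSmall J κ)
    (I : Type v) [Preorder I] (hI : CardinalDirected I κ)
    (D : J × I ⥤ K)
    (hD : ∀ (j : J) ⦃i i' : I⦄ (hii : i ≤ i'),
        F.M (D.map ((𝟙 j, homOfLE hii) : (j, i) ⟶ (j, i')))) :
    IsIso (colimitLimitToLimitColimit D) := by
  have hJobj : Cardinal.mk J < κ := by
    refine lt_of_le_of_lt (Cardinal.mk_le_of_injective
      (f := fun j : J => (⟨j, j, 𝟙 j⟩ : Σ (a : J) (b : J), a ⟶ b)) ?_) hJ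
    intro a b hab
    exact congrArg Sigma.fst hab
  -- the two families of diagrams
  have hcol : ∀ j, DiagramInM F.M ((Functor.curry.obj D).obj j) := fun j i i' hii => hD j hii
  have hlim : DiagramInM F.M (Functor.curry.obj (CategoryTheory.Prod.swap I J ⋙ D) ⋙ lim) := fun i i' hii =>
    M_limMap F ((Functor.curry.obj (CategoryTheory.Prod.swap I J ⋙ D)).map (homOfLE hii)) (fun j => hD j hii)
  have hlimw : ∀ {i i' : I} (hii : i ≤ i') (j : J),
      (Functor.curry.obj (CategoryTheory.Prod.swap I J ⋙ D) ⋙ lim).map (homOfLE hii) ≫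
        limit.π ((Functor.curry.obj (CategoryTheory.Prod.swap I J ⋙ D)).obj i') j =
      limit.π ((Functor.curry.obj (CategoryTheory.Prod.swap I J ⋙ D)).obj i) j ≫
        ((Functor.curry.obj D).obj j).map (homOfLE hii) := fun hii j =>
    limMap_π ((Functor.curry.obj (CategoryTheory.Prod.swap I J ⋙ D)).map (homOfLE hii)) j
  refine isIso_of_S h.presentation _ ?_ ?_
  · intro A hA x y hxy
    have hgen := h.gen A hA
    obtain ⟨i₁, a₁, ha₁⟩ := gen_factor hgen hI hlim (colimit.isColimit _) x
    obtain ⟨i₂, b₂, hb₂⟩ := gen_factor hgen hI hlim (colimit.isColimit _) y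
    obtain ⟨i, h₁, h₂⟩ := exists_bound₂ hκ hI i₁ i₂
    obtain ⟨a, ha⟩ : ∃ a : A ⟶ (Functor.curry.obj (CategoryTheory.Prod.swap I J ⋙ D) ⋙ lim).obj i,
        a ≫ colimit.ι _ i = x :=
      ⟨a₁ ≫ (Functor.curry.obj (CategoryTheory.Prod.swap I J ⋙ D) ⋙ lim).map (homOfLE h₁), by
        rw [Category.assoc, colimit.w]; exact ha₁⟩
    obtain ⟨b, hb⟩ : ∃ b : A ⟶ (Functor.curry.obj (CategoryTheory.Prod.swap I J ⋙ D) ⋙ lim).obj i,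
        b ≫ colimit.ι _ i = y :=
      ⟨b₂ ≫ (Functor.curry.obj (CategoryTheory.Prod.swap I J ⋙ D) ⋙ lim).map (homOfLE h₂), by
        rw [Category.assoc, colimit.w]; exact hb₂⟩
    have key : ∀ j, ∃ (k : I) (hk : i ≤ k),
        (a ≫ limit.π ((Functor.curry.obj (CategoryTheory.Prod.swap I J ⋙ D)).obj i) j) ≫
          ((Functor.curry.obj D).obj j).map (homOfLE hk) =
        (b ≫ limit.π ((Functor.curry.obj (CategoryTheory.Prod.swap I J ⋙ D)).obj i) j) ≫
          ((Functor.curry.obj D).obj j).map (homOfLE hk) := by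
      intro j
      refine gen_eq hκ hgen hI (hcol j) (colimit.isColimit _)
        (a ≫ limit.π ((Functor.curry.obj (CategoryTheory.Prod.swap I J ⋙ D)).obj i) j)
        (b ≫ limit.π ((Functor.curry.obj (CategoryTheory.Prod.swap I J ⋙ D)).obj i) j) ?_
      have e1 := congrArg (fun t => t ≫ limit.π (Functor.curry.obj D ⋙ colim) j) hxy
      rw [← ha, ← hb] at e1
      simp only [Category.assoc] at e1
      erw [ι_colimitLimitToLimitColimit_π D j i] at e1
      erw [Category.assoc, Category.assoc]
      exact e1
    choose k hk hkeq using key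
    obtain ⟨m₀, hm₀⟩ := exists_bound hI hJobj k
    obtain ⟨m, hm, him⟩ := exists_bound₂ hκ hI m₀ i
    have hfin : a ≫ (Functor.curry.obj (CategoryTheory.Prod.swap I J ⋙ D) ⋙ lim).map (homOfLE him) =
        b ≫ (Functor.curry.obj (CategoryTheory.Prod.swap I J ⋙ D) ⋙ lim).map (homOfLE him) := by
      refine limit.hom_ext fun j => ?_
      have hsplit : ((Functor.curry.obj D).obj j).map (homOfLE him) =
          ((Functor.curry.obj D).obj j).map (homOfLE (hk j)) ≫
            ((Functor.curry.obj D).obj j).map (homOfLE ((hm₀ j).trans hm)) := by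
        rw [← Functor.map_comp]; rfl
      have e2 := congrArg
        (fun t => t ≫ ((Functor.curry.obj D).obj j).map (homOfLE ((hm₀ j).trans hm))) (hkeq j)
      simp only [Category.assoc] at e2
      rw [← hsplit] at e2
      erw [Category.assoc, Category.assoc, hlimw him j]
      exact e2
    rw [← ha, ← hb, ← colimit.w _ (homOfLE him), ← Category.assoc, hfin, Category.assoc]
  · intro A hA y
    have hgen := h.gen A hA
    choose i₁ a₁ ha₁ using fun j => gen_factor hgen hI (hcol j) (colimit.isColimit _)
      (y ≫ limit.π (Functor.curry.obj D ⋙ colim) j)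
    obtain ⟨i, hi⟩ := exists_bound hI hJobj i₁
    have hex : ∀ j, ∃ a : A ⟶ ((Functor.curry.obj D).obj j).obj i,
        a ≫ colimit.ι ((Functor.curry.obj D).obj j) i = y ≫ limit.π (Functor.curry.obj D ⋙ colim) j := fun j =>
      ⟨a₁ j ≫ ((Functor.curry.obj D).obj j).map (homOfLE (hi j)), by
        rw [Category.assoc, colimit.w]; exact ha₁ j⟩
    choose a ha using hex
    have key : ∀ t : (Σ (p : J) (q : J), p ⟶ q), ∃ (k : I) (hk : i ≤ k),
        (a t.1 ≫ ((Functor.curry.obj D).map t.2.2).app i) ≫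
          ((Functor.curry.obj D).obj t.2.1).map (homOfLE hk) =
        a t.2.1 ≫ ((Functor.curry.obj D).obj t.2.1).map (homOfLE hk) := by
      rintro ⟨p, q, f⟩
      refine gen_eq hκ hgen hI (hcol q) (colimit.isColimit _)
        (a p ≫ ((Functor.curry.obj D).map f).app i) (a q) ?_
      have e1 : ((Functor.curry.obj D).map f).app i ≫ colimit.ι ((Functor.curry.obj D).obj q) i =
          colimit.ι ((Functor.curry.obj D).obj p) i ≫ (Functor.curry.obj D ⋙ colim).map f :=
        (ι_colimMap ((Functor.curry.obj D).map f) i).symm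
      have e2 : (a p ≫ ((Functor.curry.obj D).map f).app i) ≫ colimit.ι ((Functor.curry.obj D).obj q) i =
          a q ≫ colimit.ι ((Functor.curry.obj D).obj q) i := by
        rw [Category.assoc, e1, ← Category.assoc, ha p, Category.assoc, limit.w, ha q]
      exact e2
    choose k hk hkeq using key
    obtain ⟨m₀, hm₀⟩ := exists_bound hI hJ k
    obtain ⟨m, hm, him⟩ := exists_bound₂ hκ hI m₀ i
    have hcone : ∀ {p q : J} (f : p ⟶ q),
        (a p ≫ ((Functor.curry.obj D).obj p).map (homOfLE him)) ≫ ((Functor.curry.obj D).map f).app m =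
        a q ≫ ((Functor.curry.obj D).obj q).map (homOfLE him) := by
      intro p q f
      have hsplit : ((Functor.curry.obj D).obj q).map (homOfLE him) =
          ((Functor.curry.obj D).obj q).map (homOfLE (hk ⟨p, q, f⟩)) ≫
            ((Functor.curry.obj D).obj q).map (homOfLE ((hm₀ ⟨p, q, f⟩).trans hm)) := by
        rw [← Functor.map_comp]; rfl
      rw [Category.assoc, ((Functor.curry.obj D).map f).naturality, hsplit, ← Category.assoc,
        ← Category.assoc, ← Category.assoc, hkeq ⟨p, q, f⟩]
    let c : Cone ((Functor.curry.obj (CategoryTheory.Prod.swap I J ⋙ D)).obj m) :=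
      { pt := A
        π := { app := fun j => a j ≫ ((Functor.curry.obj D).obj j).map (homOfLE him)
               naturality := fun p q f =>
                 (Category.id_comp _).trans (hcone f).symm } }
    have hc : ∀ j, limit.lift _ c ≫ limit.π _ j =
        a j ≫ ((Functor.curry.obj D).obj j).map (homOfLE him) := fun j => limit.lift_π c j
    refine ⟨limit.lift _ c ≫ colimit.ι (Functor.curry.obj (CategoryTheory.Prod.swap I J ⋙ D) ⋙ lim) m, ?_⟩
    refine limit.hom_ext fun j => ?_
    rw [Category.assoc, Category.assoc]
    erw [ι_colimitLimitToLimitColimit_π D j m]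
    rw [← ha j, ← colimit.w _ (homOfLE him), ← Category.assoc, ← Category.assoc, ← hc j]

end LocallyGen
end
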